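/- arXiv:2407.05381 — 5 statements merged into one kernel-verified Lean document; each statement's English description precedes it below -/
import Mathlib

section
/- Let I be a finite set of offline vertices with weights w_i ≥ 0, T a finite set of online vertices, and E ⊆ I × T a set of edges. Let g(x) = (e^x − 1)/(e − 1). Let x : I × T → ℝ be nonnegative, supported on E, with ∑_{t} x_{i,t} ≤ 1 for every i ∈ I. Define dual variables y_i = w_i · g(∑_{t'} x_{i,t'}) for each i ∈ I and z_t = max_{i : (i,t) ∈ E} w_i · (1 − g(∑_{t' ≤ t} x_{i,t'})) for each t ∈ T (with z_t = 0 if t has no neighbors), where T is linearly ordered. Then y_i ≥ 0 for all i, z_t ≥ 0 for all t, and y_i + z_t ≥ w_i for every edge (i,t) ∈ E. -/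
/-- The function `g(x) = (e^x - 1)/(e - 1)`. -/
noncomputable def g (x : ℝ) : ℝ := (Real.exp x - 1) / (Real.exp 1 - 1)

theorem exp_one_sub_one_pos : 0 < Real.exp 1 - 1 :=
  sub_pos.2 (Real.one_lt_exp_iff.2 one_pos)

theorem g_mono : Monotone g := fun a b hab => by
  have := exp_one_sub_one_pos
  unfold g
  gcongr

theorem g_zero : g 0 = 0 := by simp [g]

theorem g_one : g 1 = 1 := div_self exp_one_sub_one_pos.ne'

/-- Dual feasibility of the dual solution constructed for the BALANCE algorithm:
`y i = w i * g(∑_t x i t)` and `z t = max_{i : (i,t) ∈ E} w i * (1 - g(∑_{t' ≤ t} x i t'))`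
(with `z t = 0` if `t` has no neighbors) satisfy `y i ≥ 0`, `z t ≥ 0`, and
`y i + z t ≥ w i` on every edge. -/
theorem balance_dual_feasible {I T : Type*} [Fintype I] [Fintype T] [DecidableEq I]
    [LinearOrder T]
    (w : I → ℝ) (hw : ∀ i, 0 ≤ w i)
    (E : Finset (I × T))
    (x : I → T → ℝ)
    (hx0 : ∀ i t, 0 ≤ x i t)
    (hsupp : ∀ i t, (i, t) ∉ E → x i t = 0)
    (hrow : ∀ i, ∑ t, x i t ≤ 1)
    (y : I → ℝ) (hy : ∀ i, y i = w i * g (∑ t, x i t))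
    (z : T → ℝ)
    (hz : ∀ t, z t =
      if h : (Finset.univ.filter (fun i => (i, t) ∈ E)).Nonempty then
        (Finset.univ.filter (fun i => (i, t) ∈ E)).sup' h
          (fun i => w i * (1 - g (∑ t' ∈ Finset.univ.filter (· ≤ t), x i t')))
      else 0) :
    (∀ i, 0 ≤ y i) ∧ (∀ t, 0 ≤ z t) ∧ (∀ i t, (i, t) ∈ E → w i ≤ y i + z t) := by
  have hpre : ∀ i t, ∑ t' ∈ Finset.univ.filter (· ≤ t), x i t' ≤ ∑ t', x i t' := fun i t =>
    Finset.sum_le_sum_of_subset_of_nonneg (Finset.filter_subset _ _) fun t' _ _ => hx0 i t'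
  have hterm : ∀ i t, (i, t) ∈ E →
      w i * (1 - g (∑ t' ∈ Finset.univ.filter (· ≤ t), x i t')) ≤ z t := by
    intro i t hit
    have hi : i ∈ Finset.univ.filter (fun i => (i, t) ∈ E) := by simpa using hit
    rw [hz, dif_pos ⟨i, hi⟩]
    exact Finset.le_sup' (fun i => w i * (1 - g (∑ t' ∈ Finset.univ.filter (· ≤ t), x i t'))) hi
  refine ⟨fun i => ?_, fun t => ?_, fun i t hit => ?_⟩
  · rw [hy]
    exact mul_nonneg (hw i) (g_zero ▸ g_mono (Finset.sum_nonneg fun t _ => hx0 i t))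
  · by_cases h : (Finset.univ.filter (fun i => (i, t) ∈ E)).Nonempty
    · obtain ⟨i, hi⟩ := h
      refine le_trans (mul_nonneg (hw i) (sub_nonneg.2 ?_)) (hterm i t (by simpa using hi))
      exact (g_mono ((hpre i t).trans (hrow i))).trans_eq g_one
    · rw [hz, dif_neg h]
  · have hmul := mul_le_mul_of_nonneg_left (g_mono (hpre i t)) (hw i)
    have hle := hterm i t hit
    rw [hy]
    linarith
end

section
/- Let I be a finite set of offline vertices with weights w_i ≥ 0 and let N ⊆ I be nonempty (the neighbors of an arriving online vertex). Let g(x) = (e^x − 1)/(e − 1). Let x_i ∈ [0,1] for i ∈ I be prior fractional degrees and let d_i ≥ 0 be increments with d_i = 0 for i ∉ N and x_i + d_i ≤ 1 for all i. Assume: (H1) for every i with d_i > 0, w_i · (1 − g(x_i + d_i)) = max_{j ∈ N} w_j · (1 − g(x_j + d_j)); and (H2) either ∑_i d_i = 1, or x_j + d_j = 1 for every j ∈ N. Define the primal increase ΔP = ∑_i w_i · d_i and the dual increase ΔD = z + ∑_i w_i · (g(x_i + d_i) − g(x_i)), where z = max_{j ∈ N} w_j · (1 − g(x_j + d_j)).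 Then ΔD ≤ ΔP · e/(e − 1); equivalently, ΔP ≥ (1 − 1/e) · ΔD. -/
/-- The differential identity `g' + (1 - g) = e / (e - 1)` in increment form,
using convexity of `g`. -/
theorem g_add_sub_add_mul_le (x d : ℝ) :
    g (x + d) - g x + d * (1 - g (x + d)) ≤ d * (Real.exp 1 / (Real.exp 1 - 1)) := by
  have he := exp_one_sub_one_pos
  have hexp : Real.exp x = Real.exp (x + d) * Real.exp (-d) := by
    rw [← Real.exp_add]
    ring_nf
  have hle : Real.exp (x + d) * (1 - d) ≤ Real.exp x := by
    rw [hexp]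
    exact mul_le_mul_of_nonneg_left (Real.one_sub_le_exp_neg d) (Real.exp_pos _).le
  have hdiff : d * (Real.exp 1 / (Real.exp 1 - 1)) - (g (x + d) - g x + d * (1 - g (x + d)))
      = (Real.exp x - Real.exp (x + d) * (1 - d)) / (Real.exp 1 - 1) := by
    unfold g
    field_simp
    ring
  have := div_nonneg (sub_nonneg.2 hle) he.le
  linarith

/-- Per-step primal-dual inequality for the BALANCE algorithm: if the increments `d i`
are supported on the neighborhood `N`, only increase maximizers of the marginal
utility `w i * (1 - g (x i + d i))` (hypothesis `h1`), and either a full unit is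
allocated or all neighbors are saturated (hypothesis `h2`), then the dual increase
`ΔD = z + ∑ i, w i * (g (x i + d i) - g (x i))` (where `z` is the maximum marginal
utility over `N`) and the primal increase `ΔP = ∑ i, w i * d i` satisfy
`ΔD ≤ ΔP * e/(e-1)`, equivalently `ΔP ≥ (1 - 1/e) * ΔD`. -/
theorem balance_step {I : Type*} [Fintype I]
    (w : I → ℝ) (hw : ∀ i, 0 ≤ w i)
    (N : Finset I) (hN : N.Nonempty)
    (x d : I → ℝ)
    (hx0 : ∀ i, 0 ≤ x i) (hx1 : ∀ i, x i ≤ 1)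
    (hd0 : ∀ i, 0 ≤ d i)
    (hdN : ∀ i ∉ N, d i = 0)
    (hxd : ∀ i, x i + d i ≤ 1)
    (h1 : ∀ i, 0 < d i →
      w i * (1 - g (x i + d i)) = N.sup' hN (fun j => w j * (1 - g (x j + d j))))
    (h2 : (∑ i, d i) = 1 ∨ ∀ j ∈ N, x j + d j = 1) :
    (N.sup' hN (fun j => w j * (1 - g (x j + d j)))
        + ∑ i, w i * (g (x i + d i) - g (x i))
      ≤ (∑ i, w i * d i) * (Real.exp 1 / (Real.exp 1 - 1)))
    ∧ (1 - 1 / Real.exp 1) *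
        (N.sup' hN (fun j => w j * (1 - g (x j + d j)))
          + ∑ i, w i * (g (x i + d i) - g (x i)))
      ≤ ∑ i, w i * d i := by
  have he := exp_one_sub_one_pos
  have hpos := Real.exp_pos 1
  set z := N.sup' hN (fun j => w j * (1 - g (x j + d j))) with hz
  have hzsum : z = z * ∑ i, d i := by
    rcases h2 with h | h
    · rw [h, mul_one]
    · have h0 : z = 0 := by
        rw [hz, Finset.sup'_congr hN rfl (g := fun _ => (0 : ℝ))
          (fun j hj => by rw [h j hj, g_one]; ring), Finset.sup'_const]
      rw [h0, zero_mul]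
  have hterm : ∀ i, z * d i + w i * (g (x i + d i) - g (x i))
      ≤ w i * d i * (Real.exp 1 / (Real.exp 1 - 1)) := by
    intro i
    have hzi : z * d i = w i * (1 - g (x i + d i)) * d i := by
      rcases (hd0 i).eq_or_lt with h | h
      · simp [← h]
      · rw [h1 i h]
    have := mul_le_mul_of_nonneg_left (g_add_sub_add_mul_le (x i) (d i)) (hw i)
    linarith
  have hmain : z + ∑ i, w i * (g (x i + d i) - g (x i))
      ≤ (∑ i, w i * d i) * (Real.exp 1 / (Real.exp 1 - 1)) := by
    rw [hzsum, Finset.mul_sum, ← Finset.sum_add_distrib, Finset.sum_mul]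
    exact Finset.sum_le_sum fun i _ => hterm i
  refine ⟨hmain, ?_⟩
  have hc : (0 : ℝ) ≤ 1 - 1 / Real.exp 1 := by
    rw [one_sub_div hpos.ne']
    positivity
  refine (mul_le_mul_of_nonneg_left hmain hc).trans_eq ?_
  field_simp
end

section
/- Let I be a finite set of offline vertices with weights w_i ≥ 0, T = {1, …, m} a finite ordered set of online vertices, and E ⊆ I × T a set of edges, with N(t) = {i : (i,t) ∈ E}. Let g(x) = (e^x − 1)/(e − 1). Suppose x : I × T → ℝ is nonnegative, supported on E, with ∑_t x_{i,t} ≤ 1 for every i and ∑_i x_{i,t} ≤ 1 for every t, and for each t ∈ T, writing x_i^{(t)} = ∑_{t' < t} x_{i,t'}: (a) x_{i,t} > 0 only if w_i · (1 − g(x_i^{(t)} + x_{i,t})) = max_{j ∈ N(t)} w_j · (1 − g(x_j^{(t)} + x_{j,t})); and (b) if N(t) ≠ ∅, either ∑_i x_{i,t} = 1 or x_j^{(t)} + x_{j,t} = 1 for every j ∈ N(t). Then ∑_{(i,t) ∈ E} w_i · x_{i,t} ≥ (1 − 1/e) · OPT, where OPT is the maximum of ∑_{(i,t) ∈ E} w_i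 · x'_{i,t} over all fractional matchings x' (nonnegative functions supported on E with row sums ∑_t x'_{i,t} ≤ 1 and column sums ∑_i x'_{i,t} ≤ 1). That is, the BALANCE algorithm is (1 − 1/e)-competitive for vertex-weighted online bipartite matching. -/
theorem one_sub_g (y : ℝ) :
    1 - g y = Real.exp 1 / (Real.exp 1 - 1) * (1 - Real.exp (y - 1)) := by
  have h : Real.exp 1 - 1 ≠ 0 := by
    have := Real.add_one_lt_exp (one_ne_zero : (1 : ℝ) ≠ 0)
    linarith
  have he : Real.exp 1 ≠ 0 := Real.exp_ne_zero 1
  rw [g, Real.exp_sub]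
  field_simp
  ring

theorem mul_one_sub_g_le_iff (a b y z : ℝ) :
    a * (1 - g y) ≤ b * (1 - g z) ↔
      a * (1 - Real.exp (y - 1)) ≤ b * (1 - Real.exp (z - 1)) := by
  have h : 0 < Real.exp 1 / (Real.exp 1 - 1) := by
    have := Real.add_one_lt_exp (one_ne_zero : (1 : ℝ) ≠ 0)
    exact div_pos (Real.exp_pos 1) (by linarith)
  rw [one_sub_g, one_sub_g, mul_left_comm, mul_left_comm b, mul_le_mul_iff_right₀ h]

/-- A right Riemann sum of `exp` dominates its integral. -/
theorem exp_sum_sub_exp_le {m : ℕ} (c : ℝ) (y : Fin m → ℝ) :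
    Real.exp (∑ t, y t + c) - Real.exp c ≤
      ∑ t, y t * Real.exp ((∑ t' ∈ Finset.univ.filter (· < t), y t') + y t + c) := by
  induction m with
  | zero => simp
  | succ m ih =>
    have hstep (a b : ℝ) : Real.exp (a + b + c) - Real.exp (a + c) ≤
        b * Real.exp (a + b + c) := by
      have h : Real.exp (a + c) = Real.exp (-b) * Real.exp (a + b + c) := by
        rw [← Real.exp_add]; congr 1; ring
      nlinarith [Real.add_one_le_exp (-b), Real.exp_pos (a + b + c)]
    have hi := ih (fun t => y t.castSucc)
    have hs := hstep (∑ t : Fin m, y t.castSucc) (y (Fin.last m))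
    simp only [Finset.sum_filter, Fin.sum_univ_castSucc, Fin.castSucc_lt_castSucc_iff,
      Fin.castSucc_lt_last, lt_irrefl, if_true, if_false, add_zero,
      (Fin.castSucc_lt_last _).not_gt] at hi hs ⊢
    linarith

/-- Weak duality for fractional bipartite matching with vertex weights. -/
theorem sum_mul_le_of_dual_feasible {I T : Type*} [Fintype I] [Fintype T]
    {c : ℝ} {w : I → ℝ} {x : I → T → ℝ} {α : I → ℝ} {β : T → ℝ}
    (hα : ∀ i, 0 ≤ α i) (hβ : ∀ t, 0 ≤ β t) (hx : ∀ i t, 0 ≤ x i t)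
    (hrow : ∀ i, ∑ t, x i t ≤ 1) (hcol : ∀ t, ∑ i, x i t ≤ 1)
    (h : ∀ i t, x i t ≠ 0 → c * w i ≤ α i + β t) :
    c * ∑ t, ∑ i, w i * x i t ≤ ∑ i, α i + ∑ t, β t := by
  have hterm (i : I) (t : T) : c * (w i * x i t) ≤ α i * x i t + β t * x i t := by
    by_cases h0 : x i t = 0
    · simp [h0]
    · nlinarith [mul_le_mul_of_nonneg_right (h i t h0) (hx i t)]
  calc c * ∑ t, ∑ i, w i * x i t
      ≤ ∑ t, ∑ i, (α i * x i t + β t * x i t) := by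
        simp only [Finset.mul_sum]
        exact Finset.sum_le_sum fun t _ => Finset.sum_le_sum fun i _ => hterm i t
    _ = ∑ i, α i * ∑ t, x i t + ∑ t, β t * ∑ i, x i t := by
        simp only [Finset.sum_add_distrib, Finset.mul_sum]
        rw [Finset.sum_comm]
    _ ≤ ∑ i, α i + ∑ t, β t :=
        add_le_add
          (Finset.sum_le_sum fun i _ => mul_le_of_le_one_right (hα i) (hrow i))
          (Finset.sum_le_sum fun t _ => mul_le_of_le_one_right (hβ t) (hcol t))

/-- The BALANCE (water-filling) algorithm is `(1 - 1/e)`-competitive for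
vertex-weighted online fractional bipartite matching: if the allocation `x` is a
fractional matching supported on the neighborhoods `N t` that (a) only increases
maximizers of the marginal utility `w i * (1 - g(·))` and (b) fully allocates each
arriving online vertex or saturates all its neighbors, then its value is at least
`(1 - 1/e)` times the value of every fractional matching `x'`. -/
theorem balance_competitive {I : Type*} [Fintype I] {m : ℕ}
    (w : I → ℝ) (hw : ∀ i, 0 ≤ w i)
    (N : Fin m → Finset I)
    (x : I → Fin m → ℝ)
    (hx0 : ∀ i t, 0 ≤ x i t)
    (hsupp : ∀ i t, i ∉ N t → x i t = 0)
    (hrow : ∀ i, ∑ t, x i t ≤ 1)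
    (hcol : ∀ t, ∑ i, x i t ≤ 1)
    (ha : ∀ i t, 0 < x i t → ∀ j ∈ N t,
      w j * (1 - g ((∑ t' ∈ Finset.univ.filter (· < t), x j t') + x j t))
        ≤ w i * (1 - g ((∑ t' ∈ Finset.univ.filter (· < t), x i t') + x i t)))
    (hb : ∀ t, (N t).Nonempty →
      (∑ i, x i t = 1 ∨
        ∀ j ∈ N t, (∑ t' ∈ Finset.univ.filter (· < t), x j t') + x j t = 1)) :
    ∀ x' : I → Fin m → ℝ,
      (∀ i t, 0 ≤ x' i t) →
      (∀ i t, i ∉ N t → x' i t = 0) →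
      (∀ i, ∑ t, x' i t ≤ 1) →
      (∀ t, ∑ i, x' i t ≤ 1) →
      (1 - 1 / Real.exp 1) * (∑ t, ∑ i, w i * x' i t) ≤ ∑ t, ∑ i, w i * x i t := by
  intro x' hx'0 hsupp' hrow' hcol'
  set P : I → Fin m → ℝ :=
    fun i t => (∑ t' ∈ Finset.univ.filter (· < t), x i t') + x i t with hP
  have hPle (i : I) (t : Fin m) : P i t ≤ ∑ t', x i t' := by
    have hmem : t ∉ Finset.univ.filter (· < t) := by simp
    simp only [hP]
    rw [add_comm, ← Finset.sum_insert hmem]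
    exact Finset.sum_le_sum_of_subset_of_nonneg (Finset.subset_univ _) fun t' _ _ => hx0 i t'
  have hmarg (i : I) (t : Fin m) : 0 ≤ 1 - Real.exp (P i t - 1) := by
    rw [sub_nonneg, Real.exp_le_one_iff]
    linarith [hPle i t, hrow i]
  set α : I → ℝ := fun i => w i * (Real.exp (∑ t, x i t + -1) - Real.exp (-1)) with hα
  set β : Fin m → ℝ := fun t => ∑ i, w i * (1 - Real.exp (P i t - 1)) * x i t with hβ
  have hα0 (i : I) : 0 ≤ α i := by
    refine mul_nonneg (hw i) (sub_nonneg.2 (Real.exp_le_exp.2 ?_))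
    linarith [Finset.sum_nonneg fun t (_ : t ∈ Finset.univ) => hx0 i t]
  have hβ0 (t : Fin m) : 0 ≤ β t :=
    Finset.sum_nonneg fun i _ => mul_nonneg (mul_nonneg (hw i) (hmarg i t)) (hx0 i t)
  have hfeas (j : I) (t : Fin m) (hj : j ∈ N t) :
      (1 - 1 / Real.exp 1) * w j ≤ α j + β t := by
    have hinv : 1 / Real.exp 1 = Real.exp (-1) := by rw [Real.exp_neg, one_div]
    rw [hinv]
    have hexp : Real.exp (P j t - 1) ≤ Real.exp (∑ t, x j t + -1) :=
      Real.exp_le_exp.2 (by linarith [hPle j t])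
    suffices h : w j * (1 - Real.exp (P j t - 1)) ≤ β t by
      have := mul_le_mul_of_nonneg_left hexp (hw j)
      simp only [hα]
      linarith
    rcases hb t ⟨j, hj⟩ with hfull | hsat
    · calc w j * (1 - Real.exp (P j t - 1))
          = ∑ i, w j * (1 - Real.exp (P j t - 1)) * x i t := by
            rw [← Finset.mul_sum, hfull, mul_one]
        _ ≤ β t := Finset.sum_le_sum fun i _ => by
            rcases (hx0 i t).eq_or_lt with h0 | hpos
            · simp [← h0]
            · exact mul_le_mul_of_nonneg_right
                ((mul_one_sub_g_le_iff _ _ _ _).1 (ha i t hpos j hj)) hpos.le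
    · have hone : P j t = 1 := hsat j hj
      simpa [hone] using hβ0 t
  have hvalue : ∑ i, α i + ∑ t, β t ≤ ∑ t, ∑ i, w i * x i t := by
    rw [hβ, Finset.sum_comm, Finset.sum_comm (f := fun t i => w i * x i t),
      ← Finset.sum_add_distrib]
    refine Finset.sum_le_sum fun i _ => ?_
    have h := mul_le_mul_of_nonneg_left (exp_sum_sub_exp_le (-1) (x i)) (hw i)
    have hsplit : ∑ t, w i * (1 - Real.exp (P i t - 1)) * x i t =
        ∑ t, w i * x i t - w i * ∑ t, x i t * Real.exp (P i t + -1) := by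
      rw [Finset.mul_sum, ← Finset.sum_sub_distrib]
      exact Finset.sum_congr rfl fun t _ => by rw [sub_eq_add_neg (P i t)]; ring
    rw [hsplit]
    linarith
  refine (sum_mul_le_of_dual_feasible hα0 hβ0 hx'0 hrow' hcol' fun i t h => ?_).trans hvalue
  exact hfeas i t (not_imp_comm.1 (hsupp' i t) h)
end

section
/- Let n ≥ 1 be a natural number. Suppose S_1 ⊇ S_2 ⊇ ⋯ ⊇ S_n are subsets of {1, …, n} with S_1 = {1, …, n} and |S_t| = n − t + 1 for every t, and x : {1,…,n} × {1,…,n} → ℝ is nonnegative with: x_{i,t} = 0 for i ∉ S_t; ∑_i x_{i,t} ≤ 1 for every t; ∑_t x_{i,t} ≤ 1 for every i; (greediness) for every t, either ∑_i x_{i,t} = 1 or ∑_{t' ≤ t} x_{i,t'} = 1 for every i ∈ S_t; and (adversarial deletion) for every t < n, S_{t+1} = S_t \ {i*} where i* minimizes ∑_{t' ≤ t} x_{i,t'} over i ∈ S_t. Then for every t < n, the average fill of the surviving vertices satisfies (1/|S_{t+1}|) · ∑_{i ∈ S_{t+1}} ∑_{t' ≤ t} x_{i,t'} ≥ min{1,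 ∑_{t'=1}^{t} 1/(n − t' + 1)}. -/
/-- Erasing an element of minimum value does not lower the average below a given bound. -/
theorem mul_card_erase_le_sum_erase_of_min {ι : Type*} [DecidableEq ι] {s : Finset ι}
    {f : ι → ℝ} {a : ι} {c : ℝ} (ha : a ∈ s) (hmin : ∀ j ∈ s, f a ≤ f j)
    (hc : c * (s.card : ℝ) ≤ ∑ i ∈ s, f i) :
    c * ((s.erase a).card : ℝ) ≤ ∑ i ∈ s.erase a, f i := by
  have hcard : ((s.erase a).card : ℝ) + 1 = s.card := by
    exact_mod_cast Finset.card_erase_add_one ha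
  have hsum := Finset.sum_erase_add s f ha
  rcases le_total (f a) c with h | h
  · rw [← hcard] at hc
    linarith
  · calc c * ((s.erase a).card : ℝ) ≤ f a * ((s.erase a).card : ℝ) := by gcongr
      _ = (s.erase a).card • f a := by rw [nsmul_eq_mul, mul_comm]
      _ ≤ ∑ i ∈ s.erase a, f i :=
        Finset.card_nsmul_le_sum _ _ _ fun j hj => hmin j (Finset.mem_of_mem_erase hj)

/-- On the adversarial upper-triangular instance (nested neighborhoods
`S 1 ⊇ S 2 ⊇ ⋯ ⊇ S n` with `|S t| = n - t + 1`, where the vertex deleted at each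
step has minimum fractional degree so far), every greedy fractional matching fills
the surviving offline vertices to an average of at least
`min {1, ∑_{t'=1}^{t} 1/(n - t' + 1)}` after each time `t < n`. -/
theorem adversarial_average_fill (n : ℕ) (hn : 1 ≤ n)
    (S : ℕ → Finset (Fin n))
    (hS1 : S 1 = Finset.univ)
    (hcard : ∀ t, 1 ≤ t → t ≤ n → (S t).card = n - t + 1)
    (hnested : ∀ t, 1 ≤ t → t < n → S (t + 1) ⊆ S t)
    (x : Fin n → ℕ → ℝ)
    (hx0 : ∀ i t, 0 ≤ x i t)
    (hsupp : ∀ i t, 1 ≤ t → t ≤ n → i ∉ S t → x i t = 0)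
    (hcol : ∀ t, ∑ i, x i t ≤ 1)
    (hrow : ∀ i, ∑ t ∈ Finset.Icc 1 n, x i t ≤ 1)
    (hgreedy : ∀ t, 1 ≤ t → t ≤ n →
      (∑ i, x i t = 1 ∨ ∀ i ∈ S t, ∑ t' ∈ Finset.Icc 1 t, x i t' = 1))
    (hdel : ∀ t, 1 ≤ t → t < n → ∃ i' ∈ S t,
      (∀ j ∈ S t, ∑ t' ∈ Finset.Icc 1 t, x i' t' ≤ ∑ t' ∈ Finset.Icc 1 t, x j t')
      ∧ S (t + 1) = (S t).erase i') :
    ∀ t, 1 ≤ t → t < n →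
      min 1 (∑ t' ∈ Finset.Icc 1 t, (1 : ℝ) / ((n : ℝ) - t' + 1)) ≤
        (∑ i ∈ S (t + 1), ∑ t' ∈ Finset.Icc 1 t, x i t') / ((S (t + 1)).card : ℝ) := by
  have hmain : ∀ t, t < n →
      min 1 (∑ t' ∈ Finset.Icc 1 t, (1 : ℝ) / ((n : ℝ) - t' + 1)) * ((S (t + 1)).card : ℝ) ≤
        ∑ i ∈ S (t + 1), ∑ t' ∈ Finset.Icc 1 t, x i t' := by
    intro t
    induction t with
    | zero => intro _; simp
    | succ t ih =>
      intro ht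
      have hprev := ih (by omega)
      obtain ⟨a, ha, hmin, herase⟩ := hdel (t + 1) (by omega) ht
      rw [herase]
      refine mul_card_erase_le_sum_erase_of_min ha hmin ?_
      rcases hgreedy (t + 1) (by omega) ht.le with hfull | hfilled
      · have hin : ∑ i ∈ S (t + 1), x i (t + 1) = 1 := by
          rw [← hfull]
          exact Finset.sum_subset (Finset.subset_univ _)
            fun i _ hi => hsupp i (t + 1) (by omega) ht.le hi
        have hcard' : ((S (t + 1)).card : ℝ) = (n : ℝ) - (t + 1 : ℕ) + 1 := by
          rw [hcard (t + 1) (by omega) ht.le, Nat.cast_add, Nat.cast_sub ht.le, Nat.cast_one]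
        have hpos : (0 : ℝ) < (S (t + 1)).card := by
          exact_mod_cast Finset.card_pos.mpr ⟨a, ha⟩
        simp only [Finset.sum_Icc_succ_top (Nat.le_add_left 1 t), Finset.sum_add_distrib]
        rw [hin, ← hcard']
        set H := ∑ t' ∈ Finset.Icc 1 t, (1 : ℝ) / ((n : ℝ) - t' + 1)
        have hstep : min 1 (H + 1 / ((S (t + 1)).card : ℝ)) ≤
            min 1 H + 1 / ((S (t + 1)).card : ℝ) := by
          rw [← min_add_add_right]
          exact min_le_min_right _ (le_add_of_nonneg_right (by positivity))
        calc _ ≤ (min 1 H + 1 / ((S (t + 1)).card : ℝ)) * ((S (t + 1)).card : ℝ) := by gcongr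
          _ = min 1 H * ((S (t + 1)).card : ℝ) + 1 := by field_simp
          _ ≤ _ := by gcongr
      · rw [Finset.sum_congr rfl hfilled, Finset.sum_const, nsmul_eq_mul, mul_one]
        exact mul_le_of_le_one_left (Nat.cast_nonneg _) (min_le_left _ _)
  intro t _ ht
  have hpos : (0 : ℝ) < (S (t + 1)).card := by
    rw [hcard (t + 1) (by omega) ht]
    positivity
  exact (le_div_iff₀ hpos).mpr (hmain t ht)
end

section
/- Fix a natural number n ≥ 1. An online fractional bipartite matching algorithm on n offline and n online vertices is a function A assigning to every bipartite graph G (specified by neighborhoods N_G(t) ⊆ {1,…,n} for each online vertex t ∈ {1,…,n}) a nonnegative matrix x^G with x^G_{i,t} = 0 whenever i ∉ N_G(t), ∑_i x^G_{i,t} ≤ 1 for every t, ∑_t x^G_{i,t} ≤ 1 for every i, and satisfying the online (causality) property: if two graphs G and G' satisfy N_G(t') = N_{G'}(t') for all t' ≤ t, then x^G_{i,t'} = x^{G'}_{i,t'} for all i and all t' ≤ t. Then for every such algorithm A there exists a bipartite graph G with nested neighborhoods N_G(1) ⊇ N_G(2) ⊇ ⋯ ⊇ N_G(n) and |N_G(t)|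 = n − t + 1 for all t (so G contains a perfect matching and the maximum fractional matching value of G is n), such that ∑_{i,t} x^G_{i,t} ≤ n(1 − 1/e) + 1. Consequently, the competitive ratio of every fractional online bipartite matching algorithm is at most 1 − 1/e + 1/n. -/
/-- The nested instance in which the online vertex `t` sees the offline vertices `σ j`, `t ≤ j`. -/
def upperTriangularGraph {n : ℕ} (σ : Equiv.Perm (Fin n)) (t : Fin n) : Finset (Fin n) :=
  (Finset.Ici t).map σ.toEmbedding

theorem upperTriangularGraph_anti {n : ℕ} (σ : Equiv.Perm (Fin n)) :
    Antitone (upperTriangularGraph σ) := fun _ _ h =>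
  Finset.map_subset_map.2 (Finset.Ici_subset_Ici.2 h)

theorem card_upperTriangularGraph {n : ℕ} (σ : Equiv.Perm (Fin n)) (t : Fin n) :
    (upperTriangularGraph σ t).card = n - t.val := by
  simp [upperTriangularGraph]

/-- Exchanging two labels that are both still present at time `t` is invisible up to time `t`. -/
theorem upperTriangularGraph_mul_swap {n : ℕ} (σ : Equiv.Perm (Fin n)) {t j t' : Fin n}
    (hj : t ≤ j) (ht' : t' ≤ t) :
    upperTriangularGraph (σ * Equiv.swap t j) t' = upperTriangularGraph σ t' := by
  apply Finset.eq_of_subset_of_card_le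
  · intro i hi
    simp only [upperTriangularGraph, Finset.mem_map, Finset.mem_Ici, Equiv.coe_toEmbedding,
      Equiv.Perm.mul_apply] at hi ⊢
    obtain ⟨k, hk, rfl⟩ := hi
    refine ⟨Equiv.swap t j k, ?_, rfl⟩
    rw [Equiv.swap_apply_def]
    split_ifs
    exacts [ht'.trans hj, ht', hk]
  · simp only [card_upperTriangularGraph, le_refl]

/-- By causality, a uniformly random labelling gives all the vertices present at time `t`
the same expected allocation. -/
theorem sum_perm_alloc_eq {n : ℕ} {A : (Fin n → Finset (Fin n)) → (Fin n → Fin n → ℝ)}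
    (honline : ∀ G G' : Fin n → Finset (Fin n), ∀ t : Fin n,
      (∀ t' ≤ t, G t' = G' t') → ∀ i, ∀ t' ≤ t, A G i t' = A G' i t')
    {t j : Fin n} (hj : t ≤ j) :
    ∑ σ : Equiv.Perm (Fin n), A (upperTriangularGraph σ) (σ j) t =
      ∑ σ : Equiv.Perm (Fin n), A (upperTriangularGraph σ) (σ t) t := by
  rw [← Equiv.sum_comp (Equiv.mulRight (Equiv.swap t j))]
  refine Finset.sum_congr rfl fun σ _ => ?_
  simp only [Equiv.coe_mulRight, Equiv.Perm.mul_apply, Equiv.swap_apply_right]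
  exact honline _ _ t (fun t' ht' => upperTriangularGraph_mul_swap σ hj ht') _ t le_rfl

theorem sum_alloc_upperTriangularGraph {n : ℕ}
    {A : (Fin n → Finset (Fin n)) → (Fin n → Fin n → ℝ)}
    (hsupp : ∀ G i t, i ∉ G t → A G i t = 0) (σ : Equiv.Perm (Fin n)) (t : Fin n) :
    ∑ i, A (upperTriangularGraph σ) i t =
      ∑ j ∈ Finset.Ici t, A (upperTriangularGraph σ) (σ j) t := by
  rw [← Finset.sum_subset (Finset.subset_univ (upperTriangularGraph σ t))
    fun i _ hi => hsupp _ i t hi]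
  exact Finset.sum_map _ _ _

theorem sum_perm_sum_alloc {n : ℕ} {A : (Fin n → Finset (Fin n)) → (Fin n → Fin n → ℝ)}
    (hsupp : ∀ G i t, i ∉ G t → A G i t = 0)
    (honline : ∀ G G' : Fin n → Finset (Fin n), ∀ t : Fin n,
      (∀ t' ≤ t, G t' = G' t') → ∀ i, ∀ t' ≤ t, A G i t' = A G' i t') (t : Fin n) :
    ∑ σ : Equiv.Perm (Fin n), ∑ i, A (upperTriangularGraph σ) i t =
      ((n : ℝ) - t) * ∑ σ : Equiv.Perm (Fin n), A (upperTriangularGraph σ) (σ t) t := by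
  simp_rw [sum_alloc_upperTriangularGraph hsupp]
  rw [Finset.sum_comm, Finset.sum_congr rfl fun j hj =>
    sum_perm_alloc_eq honline (Finset.mem_Ici.1 hj)]
  rw [Finset.sum_const, Fin.card_Ici, nsmul_eq_mul, Nat.cast_sub t.2.le]

theorem log_le_sub_inv_div_two {x : ℝ} (hx : 1 ≤ x) : Real.log x ≤ (x - x⁻¹) / 2 := by
  rw [← Real.sinh_log (by linarith)]
  exact Real.self_le_sinh_iff.2 (Real.log_nonneg hx)

/-- Trapezoidal estimate for `n - m - m * (H_n - H_m)`. -/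
theorem sum_one_sub_div_le {m n : ℕ} (hm : 1 ≤ m) (hmn : m ≤ n) :
    ∑ k ∈ Finset.range n, (if m ≤ k then 1 - (m : ℝ) / (k + 1) else 0) ≤
      n - m - m * Real.log (n / m) + 1 / 2 - m / (2 * n) := by
  have hm' : (0 : ℝ) < m := by exact_mod_cast hm
  induction n, hmn using Nat.le_induction with
  | base =>
    rw [Finset.sum_eq_zero fun k hk => if_neg (Finset.mem_range.1 hk).not_ge,
      div_self hm'.ne', Real.log_one]
    apply le_of_eq
    field_simp
    ring
  | succ n hmn ih =>
    have hn : (0 : ℝ) < n := hm'.trans_le (by exact_mod_cast hmn)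
    have hlog : Real.log ((n + 1 : ℝ) / m) =
        Real.log (n / m) + Real.log ((n + 1 : ℝ) / n) := by
      rw [← Real.log_mul (by positivity) (by positivity)]
      congr 1
      field_simp
    have hstep := log_le_sub_inv_div_two (x := (n + 1 : ℝ) / n)
      ((one_le_div hn).2 (by linarith))
    have hmul := mul_le_mul_of_nonneg_left hstep hm'.le
    have hid : (m : ℝ) * (((n + 1 : ℝ) / n - ((n + 1 : ℝ) / n)⁻¹) / 2) =
        m / (n + 1) + m / (2 * n) - m / (2 * (n + 1)) := by
      field_simp
      ring
    rw [Finset.sum_range_succ, if_pos hmn]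
    push_cast
    rw [hlog]
    linarith

theorem exists_threshold_sum_le {n : ℕ} (hn : 1 ≤ n) : ∃ m : ℕ,
    m + ∑ k ∈ Finset.range n, (if m ≤ k then 1 - (m : ℝ) / (k + 1) else 0) ≤
      n * (1 - 1 / Real.exp 1) + 1 := by
  have hn' : (0 : ℝ) < n := by exact_mod_cast hn
  obtain ⟨a, ha⟩ : ∃ a : ℝ, a = n / Real.exp 1 := ⟨_, rfl⟩
  have ha0 : 0 < a := ha ▸ by positivity
  have hna : (n : ℝ) * (1 - 1 / Real.exp 1) = n - a := by rw [ha]; ring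
  have han : a ≤ n := ha ▸ div_le_self hn'.le (Real.one_le_exp zero_le_one)
  rw [hna]
  rcases lt_or_ge a 1 with h1 | h1
  · refine ⟨0, ?_⟩
    simp
    linarith
  refine ⟨⌊a⌋₊, ?_⟩
  have hm1 : 1 ≤ ⌊a⌋₊ := Nat.le_floor (by simpa using h1)
  have hma := Nat.floor_le ha0.le
  have ham := Nat.lt_floor_add_one a
  have hmn : ⌊a⌋₊ ≤ n := by exact_mod_cast hma.trans han
  have key := sum_one_sub_div_le hm1 hmn
  generalize ⌊a⌋₊ = m at *
  have hm1' : (1 : ℝ) ≤ m := by exact_mod_cast hm1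
  have hm0 : (0 : ℝ) < m := by linarith
  have hlog : Real.log (n / m) = 1 + Real.log (a / m) := by
    rw [show (n : ℝ) / m = Real.exp 1 * (a / m) by rw [ha]; field_simp,
      Real.log_mul (Real.exp_pos 1).ne' (by positivity), Real.log_exp]
  have hinv := Real.one_sub_inv_le_log_of_pos (show 0 < a / m by positivity)
  rw [inv_div] at hinv
  have hmul := mul_le_mul_of_nonneg_left hinv hm0.le
  have hsq : (a - m) ^ 2 / a ≤ 1 / 2 := by
    rw [div_le_iff₀ ha0]
    rcases le_or_gt a 2 with h2 | h2
    · nlinarith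
    · nlinarith
  have hid : (a - m) ^ 2 / a = a - m - m * (1 - m / a) := by
    field_simp
  have hpos : 0 ≤ (m : ℝ) / (2 * n) := by positivity
  rw [hlog] at key
  linarith

/-- The value of the linear program maximizing `∑ (n - t) y_t` subject to `(n - t) y_t ≤ N` and
`∑ y_t ≤ N`. -/
theorem sum_sub_mul_le {n : ℕ} (hn : 1 ≤ n) {N : ℝ} (hN : 0 ≤ N) {y : Fin n → ℝ}
    (hy0 : ∀ t, 0 ≤ y t) (hy : ∀ t, ((n : ℝ) - t) * y t ≤ N) (hsum : ∑ t, y t ≤ N) :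
    ∑ t : Fin n, ((n : ℝ) - t) * y t ≤ N * (n * (1 - 1 / Real.exp 1) + 1) := by
  obtain ⟨m, hm⟩ := exists_threshold_sum_le hn
  set g : ℕ → ℝ := fun k => if m ≤ k then 1 - (m : ℝ) / (k + 1) else 0 with hg
  have hterm : ∀ t : Fin n, ((n : ℝ) - t) * y t ≤ m * y t + N * g t.rev := by
    intro t
    have hrev : ((t.rev : ℕ) : ℝ) + 1 = n - t := by
      have h : (t.rev : ℕ) + 1 + t = n := by rw [Fin.val_rev]; omega
      rw [eq_sub_iff_add_eq]
      exact_mod_cast h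
    have hpos : (0 : ℝ) < n - t := hrev ▸ by positivity
    simp only [hg]
    split_ifs with h
    · rw [hrev]
      have hm' : (m : ℝ) ≤ n - t := by
        rw [← hrev]
        exact_mod_cast h.trans (Nat.le_succ _)
      have h1 : (0 : ℝ) ≤ 1 - m / (n - t) := sub_nonneg.2 ((div_le_one hpos).2 hm')
      have h2 := mul_le_mul_of_nonneg_right (hy t) h1
      have h3 : ((n : ℝ) - t) * y t * (1 - m / (n - t)) = (n - t) * y t - m * y t := by
        field_simp
      linarith
    · rw [mul_zero, add_zero, ← hrev]
      exact mul_le_mul_of_nonneg_right (by exact_mod_cast not_le.1 h) (hy0 t)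
  calc ∑ t : Fin n, ((n : ℝ) - t) * y t
      ≤ ∑ t : Fin n, (m * y t + N * g t.rev) := Finset.sum_le_sum fun t _ => hterm t
    _ = m * ∑ t, y t + N * ∑ k ∈ Finset.range n, g k := by
      rw [Finset.sum_add_distrib, ← Finset.mul_sum, ← Finset.mul_sum,
        ← Fin.sum_univ_eq_sum_range g n, ← Equiv.sum_comp Fin.revPerm (fun k : Fin n => g k)]
      rfl
    _ ≤ N * (m + ∑ k ∈ Finset.range n, g k) := by
      rw [mul_add, mul_comm N (m : ℝ)]
      gcongr
    _ ≤ _ := mul_le_mul_of_nonneg_left hm hN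


/-- Hardness of online fractional bipartite matching: for every online fractional
matching algorithm `A` on `n` offline and `n` online vertices (a map from graphs,
given by neighborhoods `G t`, to fractional matchings supported on them, satisfying
the causality property `honline`), there exists a graph `G` with nested
neighborhoods of sizes `n, n-1, …, 1` (hence containing a perfect matching, so of
optimum value `n`) on which the algorithm's value is at most `n(1 - 1/e) + 1`;
consequently every such algorithm has competitive ratio at most `1 - 1/e + 1/n`. -/
theorem online_fractional_matching_hardness (n : ℕ) (hn : 1 ≤ n)
    (A : (Fin n → Finset (Fin n)) → (Fin n → Fin n → ℝ))
    (hx0 : ∀ G i t, 0 ≤ A G i t)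
    (hsupp : ∀ G i t, i ∉ G t → A G i t = 0)
    (hcol : ∀ G t, ∑ i, A G i t ≤ 1)
    (hrow : ∀ G i, ∑ t, A G i t ≤ 1)
    (honline : ∀ G G' : Fin n → Finset (Fin n), ∀ t : Fin n,
      (∀ t' ≤ t, G t' = G' t') → ∀ i, ∀ t' ≤ t, A G i t' = A G' i t') :
    ∃ G : Fin n → Finset (Fin n),
      (∀ t t' : Fin n, t ≤ t' → G t' ⊆ G t) ∧
      (∀ t : Fin n, (G t).card = n - t.val) ∧
      (∑ t, ∑ i, A G i t ≤ (n : ℝ) * (1 - 1 / Real.exp 1) + 1) ∧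
      (∑ t, ∑ i, A G i t ≤ (1 - 1 / Real.exp 1 + 1 / (n : ℝ)) * n) := by
  obtain ⟨σ, -, hσ⟩ : ∃ σ ∈ (Finset.univ : Finset (Equiv.Perm (Fin n))),
      ∑ t, ∑ i, A (upperTriangularGraph σ) i t ≤ (n : ℝ) * (1 - 1 / Real.exp 1) + 1 := by
    refine Finset.exists_le_of_sum_le Finset.univ_nonempty ?_
    rw [Finset.sum_comm, Finset.sum_const, nsmul_eq_mul]
    simp_rw [sum_perm_sum_alloc hsupp honline]
    refine sum_sub_mul_le hn (Nat.cast_nonneg _)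
      (fun t => Finset.sum_nonneg fun σ _ => hx0 _ _ _) (fun t => ?_) ?_
    · rw [← sum_perm_sum_alloc hsupp honline, ← nsmul_one]
      exact Finset.sum_le_card_nsmul _ _ _ fun σ _ => hcol _ t
    · let last : Fin n := ⟨n - 1, by omega⟩
      have hlast : ∀ t : Fin n, t ≤ last := fun t => Fin.le_def.2 (Nat.le_sub_one_of_lt t.2)
      rw [Finset.sum_congr rfl fun t _ => (sum_perm_alloc_eq honline (hlast t)).symm,
        Finset.sum_comm, ← nsmul_one]
      exact Finset.sum_le_card_nsmul _ _ _ fun σ _ => hrow _ (σ last)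
  refine ⟨upperTriangularGraph σ, fun t t' h => upperTriangularGraph_anti σ h,
    card_upperTriangularGraph σ, hσ, hσ.trans_eq ?_⟩
  have hn' : (n : ℝ) ≠ 0 := by exact_mod_cast (by omega : n ≠ 0)
  rw [add_mul, one_div_mul_cancel hn', mul_comm]
end
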